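/- arXiv:2402.18356 — 3 statements merged into one kernel-verified Lean document; each statement's English description precedes it below -/
import Mathlib

section
/- Let d ≥ 1, N ≥ 1, let ψ : Fin d → ℂ be a unit vector, let Q_{ψ*} be the d×d matrix with entries Q_{ψ*}(j,k) = conj(ψ j)·(ψ k), and let R_N be the N-fold tensor power of the maximally entangled qudit density matrix with Alice's registers grouped first: R_N is indexed by (Fin N → Fin d) × (Fin N → Fin d) with entries R_N((a,b),(a',b')) = ∏_{i} Φ_d((a i, b i),(a' i, b' i)), where Φ_d((x,y),(x',y')) = (1/d)·[x = y]·[x' = y']. Let M₀ be the matrix on (Fin N → Fin d) with entries M₀(a,a') = ∏_i (I - Q_{ψ*})(a i)(a' i). Then trace((M₀ ⊗ I)·R_N) = (1 - 1/d)^N. (This computes the failure probability of the probabilistic Port-Based State Preparation protocol, giving success probability p = 1 - (1-1/d)^N as in Theorem 3.1.) -/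
open Kronecker Matrix

/-- The density matrix of the maximally entangled state
`|φ⁺_d⟩ = (1/√d) ∑_x |x⟩⊗|x⟩`. -/
noncomputable def maxEnt (d : ℕ) : Matrix (Fin d × Fin d) (Fin d × Fin d) ℂ :=
  Matrix.of fun p q => if p.1 = p.2 ∧ q.1 = q.2 then (1 / d : ℂ) else 0

/-- The resource of `N` independent maximally entangled qudit pairs, with
Alice's registers grouped first:
`R_N((a,b),(a',b')) = ∏_i Φ_d((a i, b i),(a' i, b' i))`. -/
noncomputable def resource (d N : ℕ) :
    Matrix ((Fin N → Fin d) × (Fin N → Fin d))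
      ((Fin N → Fin d) × (Fin N → Fin d)) ℂ :=
  Matrix.of fun p q => ∏ i : Fin N, maxEnt d (p.1 i, p.2 i) (q.1 i, q.2 i)

theorem resource_apply (d N : ℕ) (p q : (Fin N → Fin d) × (Fin N → Fin d)) :
    resource d N p q = if p.1 = p.2 ∧ q.1 = q.2 then (1 / d : ℂ) ^ N else 0 := by
  have h : (p.1 = p.2 ∧ q.1 = q.2) ↔ ∀ i ∈ Finset.univ, p.1 i = p.2 i ∧ q.1 i = q.2 i := by
    simp [funext_iff, forall_and]
  simp only [resource, maxEnt, Matrix.of_apply, Finset.prod_ite_zero, h, Finset.prod_const,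
    Finset.card_univ, Fintype.card_fin]

/-- Alice's half of the resource is maximally mixed. -/
theorem trace_kronecker_one_mul_resource (d N : ℕ)
    (M : Matrix (Fin N → Fin d) (Fin N → Fin d) ℂ) :
    ((M ⊗ₖ (1 : Matrix (Fin N → Fin d) (Fin N → Fin d) ℂ)) * resource d N).trace =
      (1 / d : ℂ) ^ N * M.trace := by
  simp only [Matrix.trace, Matrix.diag_apply, Matrix.mul_apply, Fintype.sum_prod_type,
    resource_apply, Matrix.kroneckerMap_apply, Matrix.one_apply, ite_and, mul_ite, mul_one,
    mul_zero, ite_mul, zero_mul, Finset.sum_ite_eq, Finset.mem_univ, if_true, Finset.mul_sum]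
  simp [mul_comm]

theorem trace_of_prod_apply {d N : ℕ} (A : Matrix (Fin d) (Fin d) ℂ) :
    (Matrix.of fun a a' : Fin N → Fin d => ∏ i, A (a i) (a' i)).trace = A.trace ^ N := by
  simp only [Matrix.trace, Matrix.diag_apply, Matrix.of_apply]
  rw [← Fintype.piFinset_univ, Finset.sum_prod_piFinset Finset.univ fun _ j => A j j]
  simp

/-- The failure probability of the probabilistic Port-Based State Preparation
protocol: `Tr[(M₀ ⊗ I)·R_N] = (1 - 1/d)^N`, where
`M₀ = ⊗_i (I - |ψ*⟩⟨ψ*|)` is Alice's failure POVM element. -/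
theorem pbsp_failure_probability (d N : ℕ) (hd : 1 ≤ d) (hN : 1 ≤ N)
    (ψ : Fin d → ℂ) (hψ : ∑ j : Fin d, star (ψ j) * ψ j = 1) :
    (((Matrix.of fun a a' : Fin N → Fin d =>
          ∏ i : Fin N,
            ((1 : Matrix (Fin d) (Fin d) ℂ) -
                Matrix.of fun x y : Fin d => star (ψ x) * ψ y) (a i) (a' i)) ⊗ₖ
        (1 : Matrix (Fin N → Fin d) (Fin N → Fin d) ℂ)) * resource d N).trace
    = (1 - 1 / d : ℂ) ^ N := by
  have hd' : (d : ℂ) ≠ 0 := by exact_mod_cast (by omega : d ≠ 0)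
  have hQ : (Matrix.of fun x y : Fin d => star (ψ x) * ψ y).trace = 1 := hψ
  rw [trace_kronecker_one_mul_resource, trace_of_prod_apply, Matrix.trace_sub, hQ,
    Matrix.trace_one, Fintype.card_fin, ← mul_pow]
  congr 1
  field_simp
end

section
/- Let d ≥ 1, N ≥ 1, let ψ : Fin d → ℂ be a unit vector, Q_{ψ*}(j,k) = conj(ψ j)·(ψ k), and let R_N((a,b),(a',b')) = ∏_i Φ_d((a i, b i),(a' i, b' i)) with Φ_d((x,y),(x',y')) = (1/d)·[x = y]·[x' = y'] be the N-fold maximally entangled resource. For x ∈ Fin N define M'_x on (Fin N → Fin d) by M'_x(a,a') = ∑_{S ⊆ Fin N, x ∈ S} (1/|S|)·∏_{i ∈ S} Q_{ψ*}(a i)(a' i)·∏_{i ∉ S}(I - Q_{ψ*})(a i)(a' i) + (1/N)·∏_i (I - Q_{ψ*})(a i)(a' i), and define Π_x on (Fin N → Fin d) by Π_x(b,b') = (ψ (b x))·conj(ψ (b' x))·∏_{i ≠ x} [b i = b' i]. Then ∑_{x ∈ Fin N} trace((M'_x ⊗ Π_x)·R_N) = 1 - (1 - 1/d)^N. (This is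 the worst-case fidelity F_wc = 1 - (1-1/d)^N of the deterministic Port-Based State Preparation protocol of Theorem 3.2, valid for every input state ψ.) -/
open Kronecker Matrix

/-- The projector `|ψ*⟩⟨ψ*|` onto the conjugate state. -/
noncomputable def projConj (d : ℕ) (ψ : Fin d → ℂ) : Matrix (Fin d) (Fin d) ℂ :=
  Matrix.of fun a b => star (ψ a) * ψ b

/-- Alice's deterministic PBSP measurement operator for outcome `x`, where the
failure outcome is spread evenly among the `N` ports. -/
noncomputable def pbspDetPOVM (d N : ℕ) (ψ : Fin d → ℂ) (x : Fin N) :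
    Matrix (Fin N → Fin d) (Fin N → Fin d) ℂ :=
  Matrix.of fun a a' =>
    ∑ S ∈ Finset.univ.filter (fun S : Finset (Fin N) => x ∈ S),
      (1 / (S.card : ℂ)) *
        ((∏ i ∈ S, projConj d ψ (a i) (a' i)) *
          ∏ i ∈ Sᶜ, ((1 : Matrix (Fin d) (Fin d) ℂ) - projConj d ψ) (a i) (a' i)) +
    (1 / (N : ℂ)) *
      ∏ i : Fin N, ((1 : Matrix (Fin d) (Fin d) ℂ) - projConj d ψ) (a i) (a' i)

/-- The projector `|ψ⟩⟨ψ|` on Bob's `x`-th register tensored with the identity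
on his other registers. -/
noncomputable def portProj (d N : ℕ) (ψ : Fin d → ℂ) (x : Fin N) :
    Matrix (Fin N → Fin d) (Fin N → Fin d) ℂ :=
  Matrix.of fun b b' =>
    ψ (b x) * star (ψ (b' x)) *
      ∏ i ∈ Finset.univ.filter (fun i : Fin N => i ≠ x),
        (if b i = b' i then (1 : ℂ) else 0)

/-- Pairing an operator with the maximally entangled resource reduces to an entrywise
(Hadamard) contraction. -/
theorem trace_kronecker_mul_resource (d N : ℕ)
    (A B : Matrix (Fin N → Fin d) (Fin N → Fin d) ℂ) :
    ((A ⊗ₖ B) * resource d N).trace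
      = (1 / d : ℂ) ^ N * ∑ a, ∑ a', A a a' * B a a' := by
  have hR : ∀ a b a' b' : Fin N → Fin d, resource d N (a', b') (a, b)
      = if a' = b' then (if a = b then (1 / d : ℂ) ^ N else 0) else 0 := by
    intro a b a' b'
    simp only [resource, maxEnt, Matrix.of_apply]
    rw [← ite_and]
    split_ifs with h
    · rw [Finset.prod_congr rfl (fun i _ => if_pos ⟨congrFun h.1 i, congrFun h.2 i⟩)]
      simp
    · have hi : ∃ i, ¬ (a' i = b' i ∧ a i = b i) := by
        by_contra! hc
        exact h ⟨funext fun i => (hc i).1, funext fun i => (hc i).2⟩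
      obtain ⟨i, hi⟩ := hi
      exact Finset.prod_eq_zero (Finset.mem_univ i) (if_neg hi)
  simp only [Matrix.trace, Matrix.diag_apply, Matrix.mul_apply, Fintype.sum_prod_type,
    Matrix.kroneckerMap_apply, hR, mul_ite, mul_zero, Finset.sum_ite_eq, Finset.mem_univ, if_true]
  rw [Finset.mul_sum]
  refine Finset.sum_congr rfl fun a _ => ?_
  rw [Finset.sum_comm, Finset.mul_sum]
  refine Finset.sum_congr rfl fun a' _ => ?_
  simp only [Finset.sum_ite_eq, Finset.mem_univ, if_true]
  ring

/-- A double sum over functions of a product of local terms factorizes. -/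
theorem sum_sum_prod_eq_prod_sum_sum {ι κ R : Type*} [Fintype ι] [DecidableEq ι] [Fintype κ]
    [CommSemiring R] (f : ι → κ → κ → R) :
    ∑ a : ι → κ, ∑ a' : ι → κ, ∏ i, f i (a i) (a' i) = ∏ i, ∑ j, ∑ k, f i j k := by
  rw [Finset.prod_univ_sum, Fintype.piFinset_univ]
  refine Finset.sum_congr rfl fun a _ => ?_
  rw [Finset.prod_univ_sum, Fintype.piFinset_univ]

/-- The contraction of a product operator with `portProj` is a product of a local expectation
at the port `x` and of local traces elsewhere. -/
theorem sum_prod_mul_portProj (d N : ℕ) (ψ : Fin d → ℂ) (x : Fin N)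
    (A : Fin N → Matrix (Fin d) (Fin d) ℂ) :
    ∑ a, ∑ a', (∏ i, A i (a i) (a' i)) * portProj d N ψ x a a'
      = ∏ i, if i = x then ∑ j, ∑ k, A i j k * (ψ j * star (ψ k)) else (A i).trace := by
  have hP : ∀ a a' : Fin N → Fin d, portProj d N ψ x a a'
      = ∏ i, if i = x then ψ (a i) * star (ψ (a' i))
          else if a i = a' i then (1 : ℂ) else 0 := by
    intro a a'
    rw [Finset.prod_ite, Finset.filter_eq' Finset.univ x, if_pos (Finset.mem_univ x),
      Finset.prod_singleton]
    rfl
  simp only [hP, ← Finset.prod_mul_distrib]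
  rw [sum_sum_prod_eq_prod_sum_sum (fun i j k => A i j k *
    (if i = x then ψ j * star (ψ k) else if j = k then (1 : ℂ) else 0))]
  refine Finset.prod_congr rfl fun i _ => ?_
  split_ifs with h
  · rfl
  · simp [Matrix.trace]

theorem trace_projConj {d : ℕ} {ψ : Fin d → ℂ} (hψ : ∑ j, star (ψ j) * ψ j = 1) :
    (projConj d ψ).trace = 1 := by
  simpa [Matrix.trace, projConj] using hψ

theorem sum_projConj_mul {d : ℕ} {ψ : Fin d → ℂ} (hψ : ∑ j, star (ψ j) * ψ j = 1) :
    ∑ j, ∑ k, projConj d ψ j k * (ψ j * star (ψ k)) = 1 := by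
  calc ∑ j, ∑ k, projConj d ψ j k * (ψ j * star (ψ k))
      = (∑ j, star (ψ j) * ψ j) * ∑ k, star (ψ k) * ψ k := by
        rw [Finset.sum_mul_sum]
        refine Finset.sum_congr rfl fun j _ => Finset.sum_congr rfl fun k _ => ?_
        simp only [projConj, Matrix.of_apply]
        ring
    _ = 1 := by rw [hψ, one_mul]

theorem sum_one_sub_projConj_mul {d : ℕ} {ψ : Fin d → ℂ} (hψ : ∑ j, star (ψ j) * ψ j = 1) :
    ∑ j, ∑ k, ((1 : Matrix (Fin d) (Fin d) ℂ) - projConj d ψ) j k * (ψ j * star (ψ k)) = 0 := by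
  simp only [Matrix.sub_apply, sub_mul, Finset.sum_sub_distrib, sum_projConj_mul hψ,
    Matrix.one_apply, ite_mul, one_mul, zero_mul, Finset.sum_ite_eq, Finset.mem_univ, if_true]
  rw [← hψ, sub_eq_zero]
  exact Finset.sum_congr rfl fun j _ => mul_comm _ _

/-- Contraction of the term of Alice's measurement indexed by `S` with `portProj`, for a port
`x ∈ S`. -/
theorem sum_subset_term_mul_portProj {d N : ℕ} {ψ : Fin d → ℂ}
    (hψ : ∑ j, star (ψ j) * ψ j = 1) {x : Fin N} {S : Finset (Fin N)} (hx : x ∈ S) :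
    ∑ a, ∑ a', ((∏ i ∈ S, projConj d ψ (a i) (a' i)) *
        ∏ i ∈ Sᶜ, ((1 : Matrix (Fin d) (Fin d) ℂ) - projConj d ψ) (a i) (a' i)) *
          portProj d N ψ x a a'
      = (d - 1 : ℂ) ^ (N - S.card) := by
  have key := sum_prod_mul_portProj d N ψ x
    (fun i => if i ∈ S then projConj d ψ else 1 - projConj d ψ)
  have hL : ∀ a a' : Fin N → Fin d,
      ∏ i, (if i ∈ S then projConj d ψ else 1 - projConj d ψ) (a i) (a' i)
        = (∏ i ∈ S, projConj d ψ (a i) (a' i)) *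
          ∏ i ∈ Sᶜ, ((1 : Matrix (Fin d) (Fin d) ℂ) - projConj d ψ) (a i) (a' i) := by
    intro a a'
    rw [← Finset.prod_mul_prod_compl S]
    congr 1
    · exact Finset.prod_congr rfl fun i hi => by rw [if_pos hi]
    · exact Finset.prod_congr rfl fun i hi => by rw [if_neg (Finset.mem_compl.mp hi)]
  simp only [hL] at key
  rw [key, ← Finset.prod_mul_prod_compl S, Finset.prod_eq_one, one_mul,
    Finset.prod_congr rfl (g := fun _ => (d - 1 : ℂ)), Finset.prod_const, Finset.card_compl,
    Fintype.card_fin]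
  · intro i hi
    have hi' := Finset.mem_compl.mp hi
    rw [if_neg (fun h : i = x => hi' (h ▸ hx)), if_neg hi', Matrix.trace_sub, trace_projConj hψ]
    simp
  · intro i hi
    simp only [if_pos hi, sum_projConj_mul hψ, trace_projConj hψ, ite_self]

/-- The failure term of Alice's measurement does not contribute to the fidelity. -/
theorem sum_failure_term_mul_portProj {d N : ℕ} {ψ : Fin d → ℂ}
    (hψ : ∑ j, star (ψ j) * ψ j = 1) (x : Fin N) :
    ∑ a, ∑ a', (∏ i, ((1 : Matrix (Fin d) (Fin d) ℂ) - projConj d ψ) (a i) (a' i)) *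
      portProj d N ψ x a a' = 0 := by
  rw [sum_prod_mul_portProj d N ψ x (fun _ => 1 - projConj d ψ)]
  refine Finset.prod_eq_zero (Finset.mem_univ x) ?_
  rw [if_pos rfl, sum_one_sub_projConj_mul hψ]

/-- The contribution of the port `x` to the fidelity. -/
theorem trace_pbspDetPOVM_kronecker_portProj {d N : ℕ} (hd : 1 ≤ d) {ψ : Fin d → ℂ}
    (hψ : ∑ j, star (ψ j) * ψ j = 1) (x : Fin N) :
    ((pbspDetPOVM d N ψ x ⊗ₖ portProj d N ψ x) * resource d N).trace
      = ∑ S : Finset (Fin N), if x ∈ S then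
          (1 / (S.card : ℂ)) * ((1 / d : ℂ) ^ S.card * (1 - 1 / d : ℂ) ^ (N - S.card)) else 0 := by
  have hd0 : (d : ℂ) ≠ 0 := by exact_mod_cast (by omega : d ≠ 0)
  rw [trace_kronecker_mul_resource]
  have hexp : ∑ a, ∑ a', pbspDetPOVM d N ψ x a a' * portProj d N ψ x a a'
      = ∑ S ∈ Finset.univ.filter (fun S : Finset (Fin N) => x ∈ S),
          (1 / (S.card : ℂ)) * (d - 1 : ℂ) ^ (N - S.card) := by
    simp only [pbspDetPOVM, Matrix.of_apply, add_mul, Finset.sum_add_distrib, Finset.sum_mul,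
      mul_assoc (1 / (N : ℂ)), ← Finset.mul_sum, sum_failure_term_mul_portProj hψ x, mul_zero,
      add_zero]
    rw [Finset.sum_congr rfl fun a _ => Finset.sum_comm, Finset.sum_comm]
    refine Finset.sum_congr rfl fun S hS => ?_
    simp only [mul_assoc (1 / (S.card : ℂ)), ← Finset.mul_sum]
    rw [sum_subset_term_mul_portProj hψ (Finset.mem_filter.mp hS).2]
  rw [hexp, Finset.mul_sum, Finset.sum_filter]
  refine Finset.sum_congr rfl fun S _ => ?_
  split_ifs
  · have hS : S.card ≤ N := by simpa using S.card_le_univ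
    have h1 : (1 - 1 / d : ℂ) = (1 / d) * (d - 1) := by field_simp
    rw [h1, mul_pow, ← mul_assoc ((1 / d : ℂ) ^ S.card), ← pow_add, Nat.add_sub_cancel' hS]
    ring
  · rfl

/-- The worst-case fidelity `F_wc = 1 - (1-1/d)^N` of the deterministic
Port-Based State Preparation protocol, valid for every input state `ψ`:
`∑_x Tr[(M'_x ⊗ Π_x)·R_N] = 1 - (1-1/d)^N`. -/
theorem pbsp_det_fidelity (d N : ℕ) (hd : 1 ≤ d) (hN : 1 ≤ N)
    (ψ : Fin d → ℂ) (hψ : ∑ j : Fin d, star (ψ j) * ψ j = 1) :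
    ∑ x : Fin N,
        ((pbspDetPOVM d N ψ x ⊗ₖ portProj d N ψ x) * resource d N).trace
    = 1 - (1 - 1 / d : ℂ) ^ N := by
  simp only [trace_pbspDetPOVM_kronecker_portProj hd hψ]
  rw [Finset.sum_comm]
  have hbinom : ∑ S : Finset (Fin N), (1 / d : ℂ) ^ S.card * (1 - 1 / d : ℂ) ^ (N - S.card)
      = 1 := by
    have h := Fintype.sum_pow_mul_eq_add_pow (Fin N) (1 / d : ℂ) (1 - 1 / d)
    simpa using h
  have hterm : ∀ S : Finset (Fin N), (∑ x, if x ∈ S then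
        (1 / (S.card : ℂ)) * ((1 / d : ℂ) ^ S.card * (1 - 1 / d : ℂ) ^ (N - S.card)) else 0)
      = (1 / d : ℂ) ^ S.card * (1 - 1 / d : ℂ) ^ (N - S.card)
        - if S = ∅ then (1 - 1 / d : ℂ) ^ N else 0 := by
    intro S
    rw [Finset.sum_ite_mem, Finset.univ_inter, Finset.sum_const, nsmul_eq_mul]
    split_ifs with h
    · simp [h]
    · have hc : (S.card : ℂ) ≠ 0 := by exact_mod_cast mt Finset.card_eq_zero.mp h
      rw [sub_zero, ← mul_assoc, mul_one_div_cancel hc, one_mul]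
  simp only [hterm, Finset.sum_sub_distrib, hbinom, Finset.sum_ite_eq', Finset.mem_univ, if_true]
end

section
/- Let d ≥ 1, N ≥ 1, let ψ : Fin d → ℂ be a unit vector, let P_ψ be the d×d matrix with entries P_ψ(j,k) = (ψ j)·conj(ψ k), and let R_N be the N-fold tensor power of the maximally entangled qudit density matrix with Alice's registers grouped first: R_N((a,b),(a',b')) = ∏_i Φ_d((a i, b i),(a' i, b' i)) where Φ_d((x,y),(x',y')) = (1/d)·[x = y]·[x' = y']. Let M_⊥ be the matrix on Bob's index type (Fin N → Fin d) with entries M_⊥(b,b') = ∏_i (I - P_ψ)(b i)(b' i). Then trace((I ⊗ M_⊥)·R_N) = (1 - 1/d)^N. (This computes the probability 1-(1-1/d)^N that Bob finds |ψ⟩ in some port before Alice measures, the time-t₁ quantity in the non-signaling argument of Theorem 5.3 bounding the optimal probabilistic PBSP success probability with maximally entangled resources by p* ≤ 1-(1-1/d)^N.) -/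
open Kronecker Matrix

/-- Bob's reduced state of the resource is maximally mixed. -/
theorem trace_one_kronecker_mul_resource (d N : ℕ)
    (M : Matrix (Fin N → Fin d) (Fin N → Fin d) ℂ) :
    (((1 : Matrix (Fin N → Fin d) (Fin N → Fin d) ℂ) ⊗ₖ M) * resource d N).trace
      = (1 / d : ℂ) ^ N * M.trace := by
  simp only [Matrix.trace, Matrix.diag_apply, Matrix.mul_apply, Fintype.sum_prod_type,
    Matrix.kroneckerMap_apply, resource_apply, Matrix.one_apply, ite_and, ite_mul, one_mul,
    zero_mul, mul_ite, mul_zero, Finset.sum_ite_eq, Finset.sum_ite_irrel,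
    Finset.sum_const_zero, Finset.mem_univ, if_true, Finset.mul_sum]
  simp [mul_comm]

theorem trace_of_prod {ι n R : Type*} [Fintype ι] [DecidableEq ι] [Fintype n] [CommSemiring R]
    (A : Matrix n n R) :
    (Matrix.of fun b b' : ι → n => ∏ i, A (b i) (b' i)).trace
      = A.trace ^ Fintype.card ι := by
  simp only [Matrix.trace, Matrix.diag_apply, Matrix.of_apply]
  rw [← Fintype.prod_sum fun (_ : ι) x => A x x, Finset.prod_const, Finset.card_univ]

/-- The time-`t₁` quantity in the non-signaling argument (Theorem 5.3): the
probability that Bob fails to find `|ψ⟩` in every port before Alice measures,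
`Tr[(I ⊗ M_⊥)·R_N] = (1 - 1/d)^N`, where `M_⊥ = ⊗_i (I - |ψ⟩⟨ψ|)`. -/
theorem pbsp_nonsignaling_t1 (d N : ℕ) (hd : 1 ≤ d) (hN : 1 ≤ N)
    (ψ : Fin d → ℂ) (hψ : ∑ j : Fin d, star (ψ j) * ψ j = 1) :
    (((1 : Matrix (Fin N → Fin d) (Fin N → Fin d) ℂ) ⊗ₖ
        (Matrix.of fun b b' : Fin N → Fin d =>
          ∏ i : Fin N,
            ((1 : Matrix (Fin d) (Fin d) ℂ) -
                Matrix.of fun x y : Fin d => ψ x * star (ψ y)) (b i) (b' i))) *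
      resource d N).trace
    = (1 - 1 / d : ℂ) ^ N := by
  have htrace : ((1 : Matrix (Fin d) (Fin d) ℂ) -
      Matrix.of fun x y : Fin d => ψ x * star (ψ y)).trace = d - 1 := by
    rw [Matrix.trace_sub, Matrix.trace_one, Fintype.card_fin, ← hψ]
    simp [Matrix.trace, mul_comm]
  have hd0 : (d : ℂ) ≠ 0 := Nat.cast_ne_zero.mpr (by lia)
  rw [trace_one_kronecker_mul_resource, trace_of_prod, htrace, Fintype.card_fin, ← mul_pow]
  congr 1
  field_simp
end
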